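/- arXiv:1806.07499 — 5 statements merged into one kernel-verified Lean document; each statement's English description precedes it below -/
import Mathlib

section
/- The function w ↦ (Y(w))^{−1/p} is strictly increasing and convex on the open interval (wα, wo). -/
open Real Set

noncomputable section

/-- The system (S) of two equations in the unknowns `y` and `η`. -/
def SystemS (κ δ p α y η : ℝ) : Prop :=
  α * Real.log η - Real.log y + α / (η * (1 - p)) - 1 / y = α * (1 + p) - 1 ∧
  α ^ (1 - p * (1 + κ * δ)) * (p * (1 + κ * δ) - 1) *
      (κ * η ^ (1 + κ * δ) / (1 + κ * δ) - η ^ (κ * δ) / (δ * (1 - p))) +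
    (κ * y ^ (1 + κ * δ) / (1 + κ * δ) - y ^ (κ * δ) / δ) =
  (α ^ (1 - p * (1 + κ * δ)) - 1) / (δ * (1 + κ * δ))

def C1 (κ δ p α η : ℝ) : ℝ :=
  -(κ * α / (1 + κ * δ)) *
    (Real.log η - p * Real.log α + 1 / (η * (1 - p)) + 1 / (1 + κ * δ))

def C2 (κ δ p α η : ℝ) : ℝ :=
  α ^ (1 - p * (1 + κ * δ)) / (1 + κ * δ) *
    (κ * η ^ (1 + κ * δ) / (1 + κ * δ) - η ^ (κ * δ) / (δ * (1 - p)))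

def C3 (κ δ p α η : ℝ) : ℝ :=
  -(κ * α / (1 + κ * δ)) * (Real.log η + 1 / (η * (1 - p)) - (1 + p))

def C4 (κ δ p α η : ℝ) : ℝ :=
  α ^ (1 - p * (1 + κ * δ)) / (1 + κ * δ) *
    (κ * η ^ (1 + κ * δ) / (1 + κ * δ) - η ^ (κ * δ) / (δ * (1 - p)) -
      1 / (δ * (1 + κ * δ) * (p * (1 + κ * δ) - 1)))

def C5 (κ δ p α η : ℝ) : ℝ :=
  -(κ / (1 + κ * δ)) *
    (α * Real.log η + α / (η * (1 - p)) + (1 - α) * (1 + p) + 1 / (1 + κ * δ))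

def C6 (κ δ p α η : ℝ) : ℝ :=
  C2 κ δ p α η -
    (α ^ (1 - p * (1 + κ * δ)) - 1) / (δ * (1 + κ * δ) ^ 2 * (p * (1 + κ * δ) - 1))

/-- The dual function `Û`, defined piecewise (here `η` stands for `η*`). -/
def Uhat (κ δ p α η : ℝ) (y : ℝ) : ℝ :=
  if α ^ (-p) ≤ y then
    C1 κ δ p α η * y + C2 κ δ p α η * y ^ (-(κ * δ)) +
      κ * α / (1 + κ * δ) * (y * Real.log y) + α ^ (1 - p) / (δ * (1 - p))
  else if 1 < y then
    C3 κ δ p α η * y + C4 κ δ p α η * y ^ (-(κ * δ)) +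
      κ * p ^ 3 / ((1 - p) * (p * (1 + κ * δ) - 1)) * y ^ (-(1 - p) / p)
  else
    C5 κ δ p α η * y + C6 κ δ p α η * y ^ (-(κ * δ)) +
      κ / (1 + κ * δ) * (y * Real.log y) + 1 / (δ * (1 - p))


/-- Two functions with the same value and derivative at `x`, glued at `x`. -/
lemma hasDerivAt_of_eventuallyEq_left_right {f g h : ℝ → ℝ} {x d : ℝ}
    (hg : HasDerivAt g d x) (hh : HasDerivAt h d x)
    (hfg : f =ᶠ[nhdsWithin x (Iic x)] g) (hfh : f =ᶠ[nhdsWithin x (Ici x)] h) :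
    HasDerivAt f d x := by
  have h1 : HasDerivWithinAt f d (Iic x) x :=
    hg.hasDerivWithinAt.congr_of_eventuallyEq hfg (hfg.self_of_nhdsWithin self_mem_Iic)
  have h2 : HasDerivWithinAt f d (Ici x) x :=
    hh.hasDerivWithinAt.congr_of_eventuallyEq hfh (hfh.self_of_nhdsWithin self_mem_Ici)
  have h3 := h1.union h2
  rwa [Iic_union_Ici, hasDerivWithinAt_univ] at h3

lemma hasDerivAt_logPiece (A B D E k : ℝ) {y : ℝ} (hy : 0 < y) :
    HasDerivAt (fun y : ℝ => A * y + B * y ^ (-k) + D * (y * Real.log y) + E)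
      (A + B * (-k * y ^ (-k - 1)) + D * (Real.log y + 1)) y := by
  have h1 := (hasDerivAt_id y).const_mul A
  have h2 := (Real.hasDerivAt_rpow_const (p := -k) (Or.inl hy.ne')).const_mul B
  have h3 := (Real.hasDerivAt_mul_log hy.ne').const_mul D
  simpa using ((h1.add h2).add h3).add_const E

lemma hasDerivAt_powPiece (A B D k r : ℝ) {y : ℝ} (hy : 0 < y) :
    HasDerivAt (fun y : ℝ => A * y + B * y ^ (-k) + D * y ^ r)
      (A + B * (-k * y ^ (-k - 1)) + D * (r * y ^ (r - 1))) y := by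
  have h1 := (hasDerivAt_id y).const_mul A
  have h2 := (Real.hasDerivAt_rpow_const (p := -k) (Or.inl hy.ne')).const_mul B
  have h3 := (Real.hasDerivAt_rpow_const (p := r) (Or.inl hy.ne')).const_mul D
  exact ((h1.add h2).add h3).congr_deriv (by simp)

/-- The derivative of a logarithmic piece is monotone when its coefficients are nonnegative. -/
lemma logPiece_deriv_mono {A B D k x y : ℝ} (hB : 0 ≤ B) (hD : 0 ≤ D) (hk : 0 ≤ k)
    (hx : 0 < x) (hxy : x ≤ y) :
    A + B * (-k * x ^ (-k - 1)) + D * (Real.log x + 1) ≤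
      A + B * (-k * y ^ (-k - 1)) + D * (Real.log y + 1) := by
  have h1 : y ^ (-k - 1) ≤ x ^ (-k - 1) :=
    Real.rpow_le_rpow_of_nonpos hx hxy (by linarith)
  have h2 := Real.log_le_log hx hxy
  have h3 : k * y ^ (-k - 1) ≤ k * x ^ (-k - 1) := by gcongr
  have h4 : B * (-k * x ^ (-k - 1)) ≤ B * (-k * y ^ (-k - 1)) :=
    mul_le_mul_of_nonneg_left (by linarith) hB
  gcongr

section Uhat

variable {κ δ p α η : ℝ}

lemma one_lt_rpow_neg (hα : α ∈ Ioo (0 : ℝ) 1) (hp : 0 < p) : 1 < α ^ (-p) :=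
  Real.one_lt_rpow_of_pos_of_lt_one_of_neg hα.1 hα.2 (by linarith)

lemma hasDerivAt_Uhat_of_le_one (hκ : 0 < κ) (hδ : 0 < δ) (hα : α ∈ Ioo (0 : ℝ) 1)
    (hp : 0 < p) (hp1 : p < 1) (hq : 0 < p * (1 + κ * δ) - 1) {y : ℝ} (hy : 0 < y)
    (hy1 : y ≤ 1) :
    HasDerivAt (Uhat κ δ p α η)
      (C5 κ δ p α η + C6 κ δ p α η * (-(κ * δ) * y ^ (-(κ * δ) - 1)) +
        κ / (1 + κ * δ) * (Real.log y + 1)) y := by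
  have ha := one_lt_rpow_neg hα hp
  have hc : 0 < 1 + κ * δ := by positivity
  have hp1' : 1 - p ≠ 0 := by linarith
  have hlow := hasDerivAt_logPiece (C5 κ δ p α η) (C6 κ δ p α η) (κ / (1 + κ * δ))
    (1 / (δ * (1 - p))) (κ * δ) hy
  have heq : ∀ z ≤ 1, Uhat κ δ p α η z = C5 κ δ p α η * z + C6 κ δ p α η * z ^ (-(κ * δ)) +
      κ / (1 + κ * δ) * (z * Real.log z) + 1 / (δ * (1 - p)) := fun z hz => by
    rw [Uhat, if_neg (by linarith), if_neg (by linarith)]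
  rcases hy1.lt_or_eq with hlt | rfl
  · refine hlow.congr_of_eventuallyEq ?_
    filter_upwards [Iio_mem_nhds hlt] with z hz using heq z hz.le
  have hmid := hasDerivAt_powPiece (C3 κ δ p α η) (C4 κ δ p α η)
    (κ * p ^ 3 / ((1 - p) * (p * (1 + κ * δ) - 1))) (κ * δ) (-(1 - p) / p) one_pos
  refine hasDerivAt_of_eventuallyEq_left_right hlow (hmid.congr_deriv ?_) ?_ ?_
  · simp only [Real.one_rpow, Real.log_one, C3, C4, C5, C6, C2]
    obtain ⟨q, hqe⟩ : ∃ q, q = p * (1 + κ * δ) - 1 := ⟨_, rfl⟩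
    rw [← hqe] at hq ⊢
    field_simp
    subst hqe
    ring
  · filter_upwards [self_mem_nhdsWithin] with z hz using heq z hz
  · filter_upwards [self_mem_nhdsWithin, mem_nhdsWithin_of_mem_nhds (Iio_mem_nhds ha)] with z hz hza
    rcases (mem_Ici.1 hz).lt_or_eq with h1 | rfl
    · rw [Uhat, if_neg (not_le.2 hza), if_pos h1]
    · rw [heq 1 le_rfl]
      simp only [Real.one_rpow, Real.log_one, C3, C4, C5, C6, C2]
      obtain ⟨q, hqe⟩ : ∃ q, q = p * (1 + κ * δ) - 1 := ⟨_, rfl⟩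
      rw [← hqe] at hq ⊢
      field_simp
      subst hqe
      ring

lemma rpow_neg_rpow_mid (hα : 0 < α) (hp : p ≠ 0) : (α ^ (-p)) ^ (-(1 - p) / p) = α ^ (1 - p) := by
  rw [← Real.rpow_mul hα.le]
  congr 1
  field_simp

lemma rpow_neg_rpow_mid_sub_one (hα : 0 < α) (hp : p ≠ 0) :
    (α ^ (-p)) ^ (-(1 - p) / p - 1) = α := by
  rw [← Real.rpow_mul hα.le]
  conv_rhs => rw [← Real.rpow_one α]
  congr 1
  field_simp
  ring

lemma rpow_mul_rpow_neg_rpow (hα : 0 < α) (k : ℝ) :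
    α ^ (1 - p * (1 + k)) * (α ^ (-p)) ^ (-k) = α ^ (1 - p) := by
  rw [← Real.rpow_mul hα.le, ← Real.rpow_add hα]
  ring_nf

lemma rpow_mul_rpow_neg_rpow_sub_one (hα : 0 < α) (k : ℝ) :
    α ^ (1 - p * (1 + k)) * (α ^ (-p)) ^ (-k - 1) = α := by
  rw [← Real.rpow_mul hα.le, ← Real.rpow_add hα]
  conv_rhs => rw [← Real.rpow_one α]
  ring_nf

lemma deriv_pieces_eq (hκ : 0 < κ) (hδ : 0 < δ) (hα : 0 < α)
    (hp : 0 < p) (hp1 : p < 1) (hq : 0 < p * (1 + κ * δ) - 1) :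
    C1 κ δ p α η + C2 κ δ p α η * (-(κ * δ) * (α ^ (-p)) ^ (-(κ * δ) - 1)) +
        κ * α / (1 + κ * δ) * (Real.log (α ^ (-p)) + 1) =
      C3 κ δ p α η + C4 κ δ p α η * (-(κ * δ) * (α ^ (-p)) ^ (-(κ * δ) - 1)) +
        κ * p ^ 3 / ((1 - p) * (p * (1 + κ * δ) - 1)) *
          (-(1 - p) / p * (α ^ (-p)) ^ (-(1 - p) / p - 1)) := by
  have hc : 0 < 1 + κ * δ := by positivity
  have hp1' : 1 - p ≠ 0 := by linarith
  have hdiff : (C2 κ δ p α η - C4 κ δ p α η) * (α ^ (-p)) ^ (-(κ * δ) - 1) =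
      α / (δ * (1 + κ * δ) ^ 2 * (p * (1 + κ * δ) - 1)) := by
    have h := rpow_mul_rpow_neg_rpow_sub_one (p := p) hα (κ * δ)
    calc _ = (α ^ (1 - p * (1 + κ * δ)) * (α ^ (-p)) ^ (-(κ * δ) - 1)) /
          (δ * (1 + κ * δ) ^ 2 * (p * (1 + κ * δ) - 1)) := by
            simp only [C2, C4]; field_simp; ring
      _ = _ := by rw [h]
  have hlin : C1 κ δ p α η - C3 κ δ p α η =
      -(κ * α / (1 + κ * δ)) * (-p * Real.log α + 1 / (1 + κ * δ) + (1 + p)) := by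
    simp only [C1, C3]; ring
  rw [rpow_neg_rpow_mid_sub_one hα hp.ne', Real.log_rpow hα, ← sub_eq_zero]
  calc _ = (C1 κ δ p α η - C3 κ δ p α η) - (κ * δ) *
        ((C2 κ δ p α η - C4 κ δ p α η) * (α ^ (-p)) ^ (-(κ * δ) - 1)) +
        κ * α / (1 + κ * δ) * (-p * Real.log α + 1) -
        κ * p ^ 3 / ((1 - p) * (p * (1 + κ * δ) - 1)) * (-(1 - p) / p * α) := by ring
    _ = 0 := by
      rw [hdiff, hlin]
      obtain ⟨q, hqe⟩ : ∃ q, q = p * (1 + κ * δ) - 1 := ⟨_, rfl⟩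
      rw [← hqe] at hq ⊢
      field_simp
      subst hqe
      ring

lemma pieces_eq (hκ : 0 < κ) (hδ : 0 < δ) (hα : 0 < α)
    (hp : 0 < p) (hp1 : p < 1) (hq : 0 < p * (1 + κ * δ) - 1) :
    C1 κ δ p α η * α ^ (-p) + C2 κ δ p α η * (α ^ (-p)) ^ (-(κ * δ)) +
        κ * α / (1 + κ * δ) * (α ^ (-p) * Real.log (α ^ (-p))) + α ^ (1 - p) / (δ * (1 - p)) =
      C3 κ δ p α η * α ^ (-p) + C4 κ δ p α η * (α ^ (-p)) ^ (-(κ * δ)) +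
        κ * p ^ 3 / ((1 - p) * (p * (1 + κ * δ) - 1)) * (α ^ (-p)) ^ (-(1 - p) / p) := by
  have hc : 0 < 1 + κ * δ := by positivity
  have hp1' : 1 - p ≠ 0 := by linarith
  have hdiff : (C2 κ δ p α η - C4 κ δ p α η) * (α ^ (-p)) ^ (-(κ * δ)) =
      α ^ (1 - p) / (δ * (1 + κ * δ) ^ 2 * (p * (1 + κ * δ) - 1)) := by
    have h := rpow_mul_rpow_neg_rpow (p := p) hα (κ * δ)
    calc _ = (α ^ (1 - p * (1 + κ * δ)) * (α ^ (-p)) ^ (-(κ * δ))) /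
          (δ * (1 + κ * δ) ^ 2 * (p * (1 + κ * δ) - 1)) := by
            simp only [C2, C4]; field_simp; ring
      _ = _ := by rw [h]
  have hlin : C1 κ δ p α η - C3 κ δ p α η =
      -(κ * α / (1 + κ * δ)) * (-p * Real.log α + 1 / (1 + κ * δ) + (1 + p)) := by
    simp only [C1, C3]; ring
  have hα1 : α ^ (1 - p) = α * α ^ (-p) := by
    rw [sub_eq_add_neg, Real.rpow_add hα, Real.rpow_one]
  rw [rpow_neg_rpow_mid hα hp.ne', Real.log_rpow hα, ← sub_eq_zero]
  calc _ = (C1 κ δ p α η - C3 κ δ p α η) * α ^ (-p) +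
        (C2 κ δ p α η - C4 κ δ p α η) * (α ^ (-p)) ^ (-(κ * δ)) +
        κ * α / (1 + κ * δ) * (α ^ (-p) * (-p * Real.log α)) + α ^ (1 - p) / (δ * (1 - p)) -
        κ * p ^ 3 / ((1 - p) * (p * (1 + κ * δ) - 1)) * α ^ (1 - p) := by ring
    _ = 0 := by
      rw [hdiff, hlin, hα1]
      generalize α ^ (-p) = a
      obtain ⟨q, hqe⟩ : ∃ q, q = p * (1 + κ * δ) - 1 := ⟨_, rfl⟩
      rw [← hqe] at hq ⊢
      field_simp
      subst hqe
      ring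

lemma hasDerivAt_Uhat_of_rpow_le (hκ : 0 < κ) (hδ : 0 < δ) (hα : α ∈ Ioo (0 : ℝ) 1)
    (hp : 0 < p) (hp1 : p < 1) (hq : 0 < p * (1 + κ * δ) - 1) {y : ℝ} (hy : α ^ (-p) ≤ y) :
    HasDerivAt (Uhat κ δ p α η)
      (C1 κ δ p α η + C2 κ δ p α η * (-(κ * δ) * y ^ (-(κ * δ) - 1)) +
        κ * α / (1 + κ * δ) * (Real.log y + 1)) y := by
  have ha := one_lt_rpow_neg hα hp
  have hup := hasDerivAt_logPiece (C1 κ δ p α η) (C2 κ δ p α η) (κ * α / (1 + κ * δ))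
    (α ^ (1 - p) / (δ * (1 - p))) (κ * δ) (show 0 < y by linarith)
  rcases hy.lt_or_eq with hlt | rfl
  · refine hup.congr_of_eventuallyEq ?_
    filter_upwards [Ioi_mem_nhds hlt] with z hz
    rw [Uhat, if_pos (le_of_lt hz)]
  have hmid := hasDerivAt_powPiece (C3 κ δ p α η) (C4 κ δ p α η)
    (κ * p ^ 3 / ((1 - p) * (p * (1 + κ * δ) - 1))) (κ * δ) (-(1 - p) / p)
    (show 0 < α ^ (-p) by linarith)
  refine hasDerivAt_of_eventuallyEq_left_right
    (hmid.congr_deriv (deriv_pieces_eq hκ hδ hα.1 hp hp1 hq).symm) hup ?_ ?_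
  · filter_upwards [self_mem_nhdsWithin, mem_nhdsWithin_of_mem_nhds (Ioi_mem_nhds ha)] with z hz hza
    rcases (mem_Iic.1 hz).lt_or_eq with h1 | rfl
    · rw [Uhat, if_neg (not_le.2 h1), if_pos (mem_Ioi.1 hza)]
    · rw [Uhat, if_pos le_rfl, pieces_eq hκ hδ hα.1 hp hp1 hq]
  · filter_upwards [self_mem_nhdsWithin] with z hz
    rw [Uhat, if_pos (mem_Ici.1 hz)]

lemma hasDerivAt_Uhat_mid {y : ℝ} (hy1 : 1 < y) (hy : y < α ^ (-p)) :
    HasDerivAt (Uhat κ δ p α η)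
      (C3 κ δ p α η + C4 κ δ p α η * (-(κ * δ) * y ^ (-(κ * δ) - 1)) +
        κ * p ^ 3 / ((1 - p) * (p * (1 + κ * δ) - 1)) *
          (-(1 - p) / p * y ^ (-(1 - p) / p - 1))) y := by
  refine (hasDerivAt_powPiece (C3 κ δ p α η) (C4 κ δ p α η)
    (κ * p ^ 3 / ((1 - p) * (p * (1 + κ * δ) - 1))) (κ * δ) (-(1 - p) / p)
    (show 0 < y by linarith)).congr_of_eventuallyEq ?_
  filter_upwards [Ioo_mem_nhds hy1 hy] with z hz
  rw [Uhat, if_neg (not_le.2 hz.2), if_pos hz.1]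

/-- On the middle region, `-Û'` expressed through the dividend rate `x = y ^ (-1/p)`. -/
def marginalMid (κ δ p α η x : ℝ) : ℝ :=
  -C3 κ δ p α η + κ * δ * C4 κ δ p α η * x ^ (p * (1 + κ * δ)) +
    κ * p ^ 2 / (p * (1 + κ * δ) - 1) * x

lemma neg_deriv_Uhat_mid (hp : 0 < p) (hp1 : p < 1) {y : ℝ} (hy1 : 1 < y) (hy : y < α ^ (-p)) :
    -deriv (Uhat κ δ p α η) y = marginalMid κ δ p α η (y ^ (-(1 / p))) := by
  have hp1' : 1 - p ≠ 0 := by linarith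
  have hy0 : 0 < y := by linarith
  have h1 : (y ^ (-(1 / p))) ^ (p * (1 + κ * δ)) = y ^ (-(κ * δ) - 1) := by
    rw [← Real.rpow_mul hy0.le]
    congr 1
    field_simp
    ring
  have h2 : -(1 - p) / p - 1 = -(1 / p) := by field_simp; ring
  rw [(hasDerivAt_Uhat_mid hy1 hy).deriv, marginalMid, h1, h2]
  have h3 : κ * p ^ 3 / ((1 - p) * (p * (1 + κ * δ) - 1)) * (-(1 - p) / p) =
      -(κ * p ^ 2 / (p * (1 + κ * δ) - 1)) := by
    rw [div_mul_div_comm, ← neg_div, ← mul_div_mul_left (-(κ * p ^ 2)) _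
      (mul_ne_zero hp1' hp.ne')]
    ring_nf
  linear_combination -(y ^ (-(1 / p))) * h3

lemma marginalMid_concaveOn (hκ : 0 < κ) (hδ : 0 < δ) (hq : 0 < p * (1 + κ * δ) - 1)
    (hC4 : C4 κ δ p α η < 0) : ConcaveOn ℝ (Ici 0) (marginalMid κ δ p α η) := by
  have h1 := (convexOn_rpow (show 1 ≤ p * (1 + κ * δ) by linarith)).smul
    (show 0 ≤ -(κ * δ * C4 κ δ p α η) by
      have := mul_neg_of_pos_of_neg (mul_pos hκ hδ) hC4
      linarith)
  refine ⟨convex_Ici 0, fun x hx y hy a b ha hb hab => ?_⟩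
  have h2 := h1.2 hx hy ha hb hab
  simp only [smul_eq_mul, marginalMid] at h2 ⊢
  linear_combination h2 - C3 κ δ p α η * hab

lemma marginalMid_strictMonoOn (hκ : 0 < κ) (hδ : 0 < δ) (hp : 0 < p)
    (hq : 0 < p * (1 + κ * δ) - 1) (hC4 : C4 κ δ p α η < 0)
    (hC4' : 0 < δ * (1 + κ * δ) * C4 κ δ p α η + p / (p * (1 + κ * δ) - 1)) :
    StrictMonoOn (marginalMid κ δ p α η) (Icc 0 1) := by
  have hder : ∀ x : ℝ, HasDerivAt (marginalMid κ δ p α η)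
      (κ * δ * C4 κ δ p α η * (p * (1 + κ * δ) * x ^ (p * (1 + κ * δ) - 1)) +
        κ * p ^ 2 / (p * (1 + κ * δ) - 1)) x := fun x => by
    have h1 := (Real.hasDerivAt_rpow_const (x := x) (p := p * (1 + κ * δ))
      (Or.inr (by linarith))).const_mul (κ * δ * C4 κ δ p α η)
    have h2 := (hasDerivAt_id x).const_mul (κ * p ^ 2 / (p * (1 + κ * δ) - 1))
    exact ((h1.const_add (-C3 κ δ p α η)).add h2).congr_deriv (by simp)
  refine strictMonoOn_of_deriv_pos (convex_Icc 0 1)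
    (fun x _ => (hder x).continuousAt.continuousWithinAt) fun x hx => ?_
  rw [interior_Icc] at hx
  rw [(hder x).deriv]
  have hx1 : x ^ (p * (1 + κ * δ) - 1) ≤ 1 := Real.rpow_le_one hx.1.le hx.2.le hq.le
  have hneg : κ * p * (δ * (1 + κ * δ) * C4 κ δ p α η) ≤ 0 := by
    have : 0 < δ * (1 + κ * δ) := by positivity
    exact mul_nonpos_of_nonneg_of_nonpos (by positivity) (mul_neg_of_pos_of_neg this hC4).le
  calc 0 < κ * p * (δ * (1 + κ * δ) * C4 κ δ p α η + p / (p * (1 + κ * δ) - 1)) := by positivity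
    _ = κ * p * (δ * (1 + κ * δ) * C4 κ δ p α η) * 1 + κ * p ^ 2 / (p * (1 + κ * δ) - 1) := by ring
    _ ≤ κ * p * (δ * (1 + κ * δ) * C4 κ δ p α η) * x ^ (p * (1 + κ * δ) - 1) +
        κ * p ^ 2 / (p * (1 + κ * δ) - 1) := by
      gcongr ?_ + _
      exact mul_le_mul_of_nonpos_left hx1 hneg
    _ = _ := by ring

/-- The left-hand side contribution of `y` in the second equation of the system. -/
def yTerm (κ δ y : ℝ) : ℝ := κ * y ^ (1 + κ * δ) / (1 + κ * δ) - y ^ (κ * δ) / δ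

lemma yTerm_eq (hκ : 0 < κ) (hδ : 0 < δ) {y : ℝ} (hy : 0 < y) :
    yTerm κ δ y = -(y ^ (κ * δ) * (1 + κ * δ * (1 - y)) / (δ * (1 + κ * δ))) := by
  rw [yTerm, Real.rpow_add hy, Real.rpow_one]
  field_simp
  ring

lemma yTerm_neg (hκ : 0 < κ) (hδ : 0 < δ) {y : ℝ} (hy : y ∈ Ioo (0 : ℝ) 1) :
    yTerm κ δ y < 0 := by
  have hc : 0 < 1 + κ * δ := by positivity
  have h1 : 0 < 1 - y := by linarith [hy.2]
  have h2 := Real.rpow_pos_of_pos hy.1 (κ * δ)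
  rw [yTerm_eq hκ hδ hy.1, neg_lt_zero]
  positivity

lemma lt_yTerm (hκ : 0 < κ) (hδ : 0 < δ) {y : ℝ} (hy : y ∈ Ioo (0 : ℝ) 1) :
    -(1 / (δ * (1 + κ * δ))) < yTerm κ δ y := by
  have hc : 0 < 1 + κ * δ := by positivity
  have hk : 0 < κ * δ := by positivity
  have hlog : Real.log y < y - 1 := Real.log_lt_sub_one_of_pos hy.1 hy.2.ne
  have hpos : 0 < 1 + κ * δ * (1 - y) := by
    have h1 : 0 < 1 - y := by linarith [hy.2]
    positivity
  have hlt : y ^ (κ * δ) * (1 + κ * δ * (1 - y)) < 1 := by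
    have h2 : y ^ (κ * δ) < Real.exp (-(κ * δ * (1 - y))) := by
      rw [Real.rpow_def_of_pos hy.1, Real.exp_lt_exp]
      nlinarith
    have h3 : 1 + κ * δ * (1 - y) ≤ Real.exp (κ * δ * (1 - y)) := by
      linarith [Real.add_one_le_exp (κ * δ * (1 - y))]
    calc _ < Real.exp (-(κ * δ * (1 - y))) * (1 + κ * δ * (1 - y)) := by gcongr
      _ ≤ Real.exp (-(κ * δ * (1 - y))) * Real.exp (κ * δ * (1 - y)) := by gcongr
      _ = 1 := by rw [← Real.exp_add]; simp
  rw [yTerm_eq hκ hδ hy.1, neg_lt_neg_iff]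
  gcongr

lemma C4_eq (hκ : 0 < κ) (hδ : 0 < δ) (hq : 0 < p * (1 + κ * δ) - 1) {y : ℝ}
    (hS : SystemS κ δ p α y η) :
    C4 κ δ p α η =
      -(yTerm κ δ y + 1 / (δ * (1 + κ * δ))) / ((p * (1 + κ * δ) - 1) * (1 + κ * δ)) := by
  have hc : 0 < 1 + κ * δ := by positivity
  have h := hS.2
  have hy : yTerm κ δ y = (α ^ (1 - p * (1 + κ * δ)) - 1) / (δ * (1 + κ * δ)) -
    α ^ (1 - p * (1 + κ * δ)) * (p * (1 + κ * δ) - 1) *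
      (κ * η ^ (1 + κ * δ) / (1 + κ * δ) - η ^ (κ * δ) / (δ * (1 - p))) := by
    rw [yTerm]; linarith
  rw [hy, C4]
  generalize κ * η ^ (1 + κ * δ) / (1 + κ * δ) - η ^ (κ * δ) / (δ * (1 - p)) = t
  generalize α ^ (1 - p * (1 + κ * δ)) = s
  obtain ⟨q, hqe⟩ : ∃ q, q = p * (1 + κ * δ) - 1 := ⟨_, rfl⟩
  rw [← hqe] at hq ⊢
  field_simp
  subst hqe
  ring

lemma C6_eq (hκ : 0 < κ) (hδ : 0 < δ) (hq : 0 < p * (1 + κ * δ) - 1) {y : ℝ}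
    (hS : SystemS κ δ p α y η) :
    C6 κ δ p α η = -yTerm κ δ y / ((p * (1 + κ * δ) - 1) * (1 + κ * δ)) := by
  have hc : 0 < 1 + κ * δ := by positivity
  have h := C4_eq hκ hδ hq hS
  have h2 : C6 κ δ p α η =
      C4 κ δ p α η + 1 / (δ * (1 + κ * δ)) / ((p * (1 + κ * δ) - 1) * (1 + κ * δ)) := by
    simp only [C6, C4, C2]
    obtain ⟨q, hqe⟩ : ∃ q, q = p * (1 + κ * δ) - 1 := ⟨_, rfl⟩
    rw [← hqe] at hq ⊢
    field_simp
    subst hqe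
    ring
  rw [h2, h]
  ring

lemma C4_neg (hκ : 0 < κ) (hδ : 0 < δ) (hq : 0 < p * (1 + κ * δ) - 1) {y : ℝ}
    (hy : y ∈ Ioo (0 : ℝ) 1) (hS : SystemS κ δ p α y η) : C4 κ δ p α η < 0 := by
  have hc : 0 < 1 + κ * δ := by positivity
  rw [C4_eq hκ hδ hq hS]
  exact div_neg_of_neg_of_pos (by linarith [lt_yTerm hκ hδ hy]) (by positivity)

lemma C4_lower_bound (hκ : 0 < κ) (hδ : 0 < δ) (hq : 0 < p * (1 + κ * δ) - 1) {y : ℝ}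
    (hy : y ∈ Ioo (0 : ℝ) 1) (hS : SystemS κ δ p α y η) :
    0 < δ * (1 + κ * δ) * C4 κ δ p α η + p / (p * (1 + κ * δ) - 1) := by
  have hc : 0 < 1 + κ * δ := by positivity
  have h : δ * (1 + κ * δ) * C4 κ δ p α η + p / (p * (1 + κ * δ) - 1) =
      (-yTerm κ δ y * δ * (1 + κ * δ) + (p * (1 + κ * δ) - 1)) /
        ((p * (1 + κ * δ) - 1) * (1 + κ * δ)) := by
    rw [C4_eq hκ hδ hq hS]
    obtain ⟨q, hqe⟩ : ∃ q, q = p * (1 + κ * δ) - 1 := ⟨_, rfl⟩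
    rw [← hqe] at hq ⊢
    field_simp
    subst hqe
    ring
  have hy' : 0 < -yTerm κ δ y := neg_pos.2 (yTerm_neg hκ hδ hy)
  rw [h]
  positivity

lemma C6_pos (hκ : 0 < κ) (hδ : 0 < δ) (hq : 0 < p * (1 + κ * δ) - 1) {y : ℝ}
    (hy : y ∈ Ioo (0 : ℝ) 1) (hS : SystemS κ δ p α y η) : 0 < C6 κ δ p α η := by
  have hc : 0 < 1 + κ * δ := by positivity
  have hy' : 0 < -yTerm κ δ y := neg_pos.2 (yTerm_neg hκ hδ hy)
  rw [C6_eq hκ hδ hq hS]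
  positivity

lemma C2_pos (hκ : 0 < κ) (hδ : 0 < δ) (hα : α ∈ Ioo (0 : ℝ) 1) (hq : 0 < p * (1 + κ * δ) - 1)
    {y : ℝ} (hy : y ∈ Ioo (0 : ℝ) 1) (hS : SystemS κ δ p α y η) : 0 < C2 κ δ p α η := by
  have hc : 0 < 1 + κ * δ := by positivity
  have h1 : 1 < α ^ (1 - p * (1 + κ * δ)) :=
    Real.one_lt_rpow_of_pos_of_lt_one_of_neg hα.1 hα.2 (by linarith)
  have h2 := C6_pos hκ hδ hq hy hS
  have h3 : 0 ≤ (α ^ (1 - p * (1 + κ * δ)) - 1) /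
      (δ * (1 + κ * δ) ^ 2 * (p * (1 + κ * δ) - 1)) :=
    div_nonneg (by linarith) (by positivity)
  rw [C6] at h2
  linarith

lemma deriv_Uhat_free_boundary (hκ : 0 < κ) (hδ : 0 < δ) (hα : α ∈ Ioo (0 : ℝ) 1)
    (hp : 0 < p) (hp1 : p < 1) (hq : 0 < p * (1 + κ * δ) - 1) (hη : 1 < η) :
    deriv (Uhat κ δ p α η) (η * α ^ (-p)) = 0 := by
  have ha := one_lt_rpow_neg hα hp
  have hc : 0 < 1 + κ * δ := by positivity
  have hη0 : 0 < η := by linarith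
  have hp1' : 1 - p ≠ 0 := by linarith
  rw [(hasDerivAt_Uhat_of_rpow_le hκ hδ hα hp hp1 hq
    (le_mul_of_one_le_left (by linarith) hη.le)).deriv]
  have h1 : C2 κ δ p α η * (η * α ^ (-p)) ^ (-(κ * δ) - 1) =
      α / (1 + κ * δ) * (κ / (1 + κ * δ) - 1 / (η * (δ * (1 - p)))) := by
    have hs := rpow_mul_rpow_neg_rpow_sub_one (p := p) hα.1 (κ * δ)
    have hη1 : η ^ (1 + κ * δ) * η ^ (-(κ * δ) - 1) = 1 := by
      rw [← Real.rpow_add hη0]; ring_nf; simp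
    have hη2 : η ^ (κ * δ) * η ^ (-(κ * δ) - 1) = 1 / η := by
      rw [← Real.rpow_add hη0, one_div, ← Real.rpow_neg_one]; ring_nf
    rw [Real.mul_rpow hη0.le (by linarith)]
    calc _ = (α ^ (1 - p * (1 + κ * δ)) * (α ^ (-p)) ^ (-(κ * δ) - 1)) / (1 + κ * δ) *
          (κ * (η ^ (1 + κ * δ) * η ^ (-(κ * δ) - 1)) / (1 + κ * δ) -
            (η ^ (κ * δ) * η ^ (-(κ * δ) - 1)) / (δ * (1 - p))) := by rw [C2]; ring
      _ = _ := by rw [hs, hη1, hη2, mul_one, div_div]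
  rw [Real.log_mul hη0.ne' (by linarith), Real.log_rpow hα.1]
  have h2 : ∀ X : ℝ, C2 κ δ p α η * (-(κ * δ) * X) = -(κ * δ) * (C2 κ δ p α η * X) :=
    fun X => by ring
  rw [h2, h1, C1]
  field_simp
  ring

end Uhat

theorem stmt14 (μ σ δ p α κ : ℝ)
    (hμ : 0 < μ) (hσ : 0 < σ) (hδ : 0 < δ) (hκ : κ = 2 * σ ^ 2 / μ ^ 2)
    (hα : α ∈ Set.Ioo (0 : ℝ) 1) (hp1 : 1 / (1 + κ * δ) < p) (hp2 : p < 1) (ystar ηstar y0 : ℝ)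
    (hy : ystar ∈ Set.Ioo (0 : ℝ) 1) (hη : 1 < ηstar)
    (hS : SystemS κ δ p α ystar ηstar) (hy0 : y0 = ηstar * α ^ (-p)) (wstar wα wo : ℝ) (Y : ℝ → ℝ)
    (hwstar : wstar = -deriv (Uhat κ δ p α ηstar) ystar)
    (hwα : wα = -deriv (Uhat κ δ p α ηstar) (α ^ (-p)))
    (hwo : wo = -deriv (Uhat κ δ p α ηstar) 1)
    (hY : ∀ w ∈ Set.Icc (0 : ℝ) wstar,
      Y w ∈ Set.Icc ystar y0 ∧ -deriv (Uhat κ δ p α ηstar) (Y w) = w) :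
    StrictMonoOn (fun w => Y w ^ (-(1 / p))) (Set.Ioo wα wo) ∧
      ConvexOn ℝ (Set.Ioo wα wo) (fun w => Y w ^ (-(1 / p))) := by
  have hκ0 : 0 < κ := by rw [hκ]; positivity
  have hc : 0 < 1 + κ * δ := by positivity
  have hp : 0 < p := lt_trans (by positivity) hp1
  have hq : 0 < p * (1 + κ * δ) - 1 := by
    rw [div_lt_iff₀ hc] at hp1
    linarith
  have ha := one_lt_rpow_neg hα hp
  have hk : 0 ≤ κ * δ := by positivity
  have hup : ∀ x y, α ^ (-p) ≤ x → x ≤ y →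
      deriv (Uhat κ δ p α ηstar) x ≤ deriv (Uhat κ δ p α ηstar) y := fun x y hx hxy => by
    rw [(hasDerivAt_Uhat_of_rpow_le hκ0 hδ hα hp hp2 hq hx).deriv,
      (hasDerivAt_Uhat_of_rpow_le hκ0 hδ hα hp hp2 hq (hx.trans hxy)).deriv]
    have := hα.1
    exact logPiece_deriv_mono (C2_pos hκ0 hδ hα hq hy hS).le (by positivity) hk (by linarith) hxy
  have hlow : ∀ x y, 0 < x → x ≤ y → y ≤ 1 →
      deriv (Uhat κ δ p α ηstar) x ≤ deriv (Uhat κ δ p α ηstar) y := fun x y hx hxy hy1 => by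
    rw [(hasDerivAt_Uhat_of_le_one hκ0 hδ hα hp hp2 hq hx (hxy.trans hy1)).deriv,
      (hasDerivAt_Uhat_of_le_one hκ0 hδ hα hp hp2 hq (hx.trans_le hxy) hy1).deriv]
    exact logPiece_deriv_mono (C6_pos hκ0 hδ hq hy hS).le (by positivity) hk hx hxy
  have hwα0 : 0 ≤ wα := by
    have h := hup _ y0 le_rfl (hy0 ▸ le_mul_of_one_le_left (by linarith) hη.le)
    rw [hy0, deriv_Uhat_free_boundary hκ0 hδ hα hp hp2 hq hη] at h
    linarith
  have hwo1 : wo ≤ wstar := by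
    linarith [hlow ystar 1 hy.1 hy.2.le le_rfl]
  have hmem : ∀ w ∈ Ioo wα wo, Y w ∈ Ioo 1 (α ^ (-p)) ∧ -deriv (Uhat κ δ p α ηstar) (Y w) = w := by
    intro w hw
    obtain ⟨hYm, hYw⟩ := hY w ⟨hwα0.trans hw.1.le, hw.2.le.trans hwo1⟩
    refine ⟨⟨?_, ?_⟩, hYw⟩
    · by_contra! h
      linarith [hlow _ 1 (hy.1.trans_le hYm.1) h le_rfl, hw.2]
    · by_contra! h
      linarith [hup _ _ le_rfl h, hw.1]
  have hx : ∀ w ∈ Ioo wα wo, Y w ^ (-(1 / p)) ∈ Icc (0 : ℝ) 1 ∧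
      marginalMid κ δ p α ηstar (Y w ^ (-(1 / p))) = w := by
    intro w hw
    obtain ⟨hm, hw'⟩ := hmem w hw
    have hY0 : 0 < Y w := one_pos.trans hm.1
    refine ⟨⟨(Real.rpow_pos_of_pos hY0 _).le, ?_⟩, ?_⟩
    · exact Real.rpow_le_one_of_one_le_of_nonpos hm.1.le (by
        have : 0 < 1 / p := by positivity
        linarith)
    · rw [← neg_deriv_Uhat_mid hp hp2 hm.1 hm.2, hw']
  have hC4 := C4_neg hκ0 hδ hq hy hS
  have hmono := marginalMid_strictMonoOn hκ0 hδ hp hq hC4 (C4_lower_bound hκ0 hδ hq hy hS)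
  have hconc := (marginalMid_concaveOn hκ0 hδ hq hC4).subset Icc_subset_Ici_self (convex_Icc 0 1)
  refine ⟨fun u hu v hv huv => ?_, convex_Ioo _ _, fun u hu v hv s t hs ht hst => ?_⟩
  · obtain ⟨hu1, hu2⟩ := hx u hu
    obtain ⟨hv1, hv2⟩ := hx v hv
    exact (hmono.lt_iff_lt hu1 hv1).1 (by rwa [hu2, hv2])
  · obtain ⟨hu1, hu2⟩ := hx u hu
    obtain ⟨hv1, hv2⟩ := hx v hv
    obtain ⟨hz1, hz2⟩ := hx _ (convex_Ioo wα wo hu hv hs ht hst)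
    refine (hmono.le_iff_le hz1 (convex_Icc 0 1 hu1 hv1 hs ht hst)).1 ?_
    have h := hconc.2 hu1 hv1 hs ht hst
    rwa [hu2, hv2, ← hz2] at h

end
end

section
/- The map α ↦ w*(α) is strictly increasing on (0, 1); equivalently, the map α ↦ y*(α) is strictly decreasing on (0, 1). -/
open Real Set

noncomputable section

/-- The power combination `k x ^ (1 + k) - (1 + k) c x ^ k`, whose only critical point on the
positive half-line is `c`. -/
def powerGap (k c x : ℝ) : ℝ := k * x ^ (1 + k) - (1 + k) * c * x ^ k

/-- The function `log x + b / x - d`. -/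
def logGap (b d x : ℝ) : ℝ := Real.log x + b / x - d

lemma hasDerivAt_powerGap (k c : ℝ) {x : ℝ} (hx : 0 < x) :
    HasDerivAt (powerGap k c) (k * (1 + k) * x ^ (k - 1) * (x - c)) x := by
  have h1 := (Real.hasDerivAt_rpow_const (p := 1 + k) (Or.inl hx.ne')).const_mul k
  have h2 := (Real.hasDerivAt_rpow_const (p := k) (Or.inl hx.ne')).const_mul ((1 + k) * c)
  refine (h1.sub h2).congr_deriv ?_
  have : x ^ (1 + k - 1) = x ^ (k - 1) * x := by
    rw [← Real.rpow_add_one hx.ne']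
    ring_nf
  rw [this]
  ring

lemma antitoneOn_powerGap {k : ℝ} (hk : 0 < k) (c : ℝ) :
    AntitoneOn (powerGap k c) (Ioc 0 c) := by
  refine antitoneOn_of_hasDerivWithinAt_nonpos (convex_Ioc 0 c)
    (f' := fun x => k * (1 + k) * x ^ (k - 1) * (x - c))
    (fun x hx => (hasDerivAt_powerGap k c hx.1).continuousAt.continuousWithinAt) ?_ ?_
  · intro x hx
    exact (hasDerivAt_powerGap k c (interior_subset hx).1).hasDerivWithinAt
  · intro x hx
    have hx' := interior_subset hx
    have hpos : 0 < x := hx'.1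
    exact mul_nonpos_of_nonneg_of_nonpos (by positivity) (sub_nonpos.2 hx'.2)

lemma powerGap_eq (k c : ℝ) {x : ℝ} (hx : 0 < x) :
    powerGap k c x = x ^ k * (k * x - (1 + k) * c) := by
  rw [powerGap, add_comm 1 k, Real.rpow_add_one hx.ne']
  ring

/-- Bernoulli's inequality for `1 / x`, multiplied by `x ^ (1 + k)`. -/
lemma one_add_powerGap_one_pos {k x : ℝ} (hk : 0 < k) (hx : 0 < x) (hx1 : x ≠ 1) :
    0 < 1 + powerGap k 1 x := by
  have hB := one_add_mul_self_lt_rpow_one_add (s := x⁻¹ - 1) (p := 1 + k)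
    (by have := inv_pos.2 hx; linarith)
    (sub_ne_zero.2 fun h => hx1 (inv_eq_one.1 h)) (by linarith)
  rw [add_sub_cancel, Real.inv_rpow hx.le] at hB
  have hpos : 0 < x ^ (1 + k) := Real.rpow_pos_of_pos hx _
  have h := mul_lt_mul_of_pos_right hB hpos
  rw [inv_mul_cancel₀ hpos.ne', add_comm 1 k, Real.rpow_add_one hx.ne'] at h
  rw [powerGap_eq k 1 hx]
  have e : (1 + (k + 1) * (x⁻¹ - 1)) * (x ^ k * x) = x ^ k * ((1 + k) - k * x) := by
    field_simp
    ring
  rw [e] at h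
  linarith

lemma hasDerivAt_logGap (b d : ℝ) {x : ℝ} (hx : 0 < x) :
    HasDerivAt (logGap b d) ((x - b) / x ^ 2) x := by
  have h := ((Real.hasDerivAt_log hx.ne').add
    ((hasDerivAt_const x b).div (hasDerivAt_id x) hx.ne')).sub_const d
  refine h.congr_deriv ?_
  simp only [id]
  field_simp
  ring

lemma monotoneOn_logGap {b : ℝ} (hb : 0 < b) (d : ℝ) : MonotoneOn (logGap b d) (Ici b) := by
  refine monotoneOn_of_hasDerivWithinAt_nonneg (convex_Ici b) (f' := fun x => (x - b) / x ^ 2)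
    (fun x hx => (hasDerivAt_logGap b d (hb.trans_le hx)).continuousAt.continuousWithinAt) ?_ ?_
  · intro x hx
    exact (hasDerivAt_logGap b d (hb.trans_le (interior_subset hx))).hasDerivWithinAt
  · intro x hx
    exact div_nonneg (sub_nonneg.2 (interior_subset hx)) (sq_nonneg x)

lemma antitoneOn_logGap (b d : ℝ) : AntitoneOn (logGap b d) (Ioc 0 b) := by
  refine antitoneOn_of_hasDerivWithinAt_nonpos (convex_Ioc 0 b) (f' := fun x => (x - b) / x ^ 2)
    (fun x hx => (hasDerivAt_logGap b d hx.1).continuousAt.continuousWithinAt) ?_ ?_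
  · intro x hx
    exact (hasDerivAt_logGap b d (interior_subset hx).1).hasDerivWithinAt
  · intro x hx
    exact div_nonpos_of_nonpos_of_nonneg (sub_nonpos.2 (interior_subset hx).2) (sq_nonneg x)

lemma logGap_one_one_pos {x : ℝ} (hx : 0 < x) (hx1 : x < 1) : 0 < logGap 1 1 x := by
  have h := Real.log_lt_sub_one_of_pos (inv_pos.2 hx) fun h => hx1.ne (inv_eq_one.1 h)
  rw [Real.log_inv] at h
  rw [logGap, one_div]
  linarith

/-- The combination of `logGap` and `powerGap` that governs the sign of the derivative of
`logGap ^ q * (1 - q * powerGap)`. -/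
lemma log_add_sub_rpow_pos {k x : ℝ} (hk : 0 < k) (hx : 1 < x) :
    0 < Real.log x - 1 - 1 / (1 + k) + (1 + k) / (k * x) - x ^ (-(1 + k)) / (k * (1 + k)) := by
  set φ : ℝ → ℝ := fun x =>
    Real.log x - 1 - 1 / (1 + k) + (1 + k) / (k * x) - x ^ (-(1 + k)) / (k * (1 + k)) with hφ
  have hder : ∀ z : ℝ, 0 < z →
      HasDerivAt φ (z ^ (-(1 + k) - 1) / k * (1 + powerGap k 1 z)) z := by
    intro z hz
    have h1 := ((Real.hasDerivAt_log hz.ne').sub_const 1).sub_const (1 / (1 + k))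
    have h2 := (hasDerivAt_const z (1 + k)).div ((hasDerivAt_id z).const_mul k)
      (mul_pos hk hz).ne'
    have h3 := (Real.hasDerivAt_rpow_const (p := -(1 + k)) (Or.inl hz.ne')).div_const
      (k * (1 + k))
    refine ((h1.add h2).sub h3).congr_deriv ?_
    have e : z ^ (-(1 + k) - 1) = (z ^ k * z ^ 2)⁻¹ := by
      rw [← Real.rpow_natCast, ← Real.rpow_add hz, ← Real.rpow_neg hz.le]
      push_cast
      ring_nf
    have hzk : z ^ k ≠ 0 := (Real.rpow_pos_of_pos hz _).ne'
    rw [powerGap_eq k 1 hz, e]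
    simp only [id]
    field_simp
    ring
  have hmono : StrictMonoOn φ (Ici 1) := by
    refine strictMonoOn_of_hasDerivWithinAt_pos (convex_Ici 1)
      (f' := fun z => z ^ (-(1 + k) - 1) / k * (1 + powerGap k 1 z))
      (fun z hz => (hder z (zero_lt_one.trans_le hz)).continuousAt.continuousWithinAt) ?_ ?_
    · intro z hz
      exact (hder z (zero_lt_one.trans_le (interior_subset hz))).hasDerivWithinAt
    · intro z hz
      rw [interior_Ici, mem_Ioi] at hz
      have hz0 : 0 < z := zero_lt_one.trans hz
      exact mul_pos (by positivity) (one_add_powerGap_one_pos hk hz0 hz.ne')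
  have h1 : φ 1 = 0 := by
    simp only [hφ, Real.log_one, Real.one_rpow]
    field_simp
    ring
  have h := hmono (mem_Ici.2 le_rfl) (mem_Ici.2 hx.le) hx
  rwa [h1] at h

/-- Beyond the common critical point, `logGap ^ q * (1 - q * powerGap)` is strictly decreasing. -/
lemma strictAntiOn_logGap_rpow_mul {k p u v : ℝ} (hk : 0 < k) (hp0 : 0 < p) (hp1 : p < 1)
    (hq : 0 < p * (1 + k) - 1) (hu : 1 / (1 - p) ≤ u)
    (hg : 0 < logGap (1 / (1 - p)) (1 + p) u) :
    StrictAntiOn (fun x => logGap (1 / (1 - p)) (1 + p) x ^ (p * (1 + k) - 1) *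
      (1 - (p * (1 + k) - 1) * powerGap k (1 / (1 - p)) x)) (Icc u v) := by
  have h1p : 0 < 1 - p := sub_pos.2 hp1
  have hb1 : 1 < 1 / (1 - p) := by
    rw [lt_div_iff₀ h1p]
    linarith
  set b := 1 / (1 - p) with hb
  set q := p * (1 + k) - 1 with hqdef
  have hb0 : 0 < b := zero_lt_one.trans hb1
  have hgpos : ∀ x ∈ Icc u v, 0 < logGap b (1 + p) x := fun x hx =>
    hg.trans_le (monotoneOn_logGap hb0 _ hu (hu.trans hx.1) hx.1)
  have hder : ∀ x ∈ Icc u v, HasDerivAt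
      (fun x => logGap b (1 + p) x ^ q * (1 - q * powerGap k b x))
      ((x - b) / x ^ 2 * q * logGap b (1 + p) x ^ (q - 1) * (1 - q * powerGap k b x) +
        logGap b (1 + p) x ^ q * -(q * (k * (1 + k) * x ^ (k - 1) * (x - b)))) x := by
    intro x hx
    have hx0 : 0 < x := hb0.trans_le (hu.trans hx.1)
    exact ((hasDerivAt_logGap b (1 + p) hx0).rpow_const (Or.inl (hgpos x hx).ne')).mul
      (((hasDerivAt_powerGap k b hx0).const_mul q).const_sub 1)
  refine strictAntiOn_of_hasDerivWithinAt_neg (convex_Icc u v)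
    (fun x hx => (hder x hx).continuousAt.continuousWithinAt)
    (fun x hx => (hder x (interior_subset hx)).hasDerivWithinAt) ?_
  intro x hx
  have hgx := hgpos x (interior_subset hx)
  rw [interior_Icc] at hx
  have hbx : b < x := hu.trans_lt hx.1
  have hx0 : 0 < x := hb0.trans hbx
  have hΦ := log_add_sub_rpow_pos hk (hb1.trans hbx)
  have hxk : 0 < x ^ k := Real.rpow_pos_of_pos hx0 _
  have e1 : x ^ (k - 1) = x ^ k / x := Real.rpow_sub_one hx0.ne' k
  have e2 : x ^ (-(1 + k)) = (x ^ k * x)⁻¹ := by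
    rw [Real.rpow_neg hx0.le, add_comm 1 k, Real.rpow_add_one hx0.ne']
  have e3 : logGap b (1 + p) x ^ q = logGap b (1 + p) x ^ (q - 1) * logGap b (1 + p) x := by
    rw [← Real.rpow_add_one hgx.ne', sub_add_cancel]
  have hgq : 0 < logGap b (1 + p) x ^ (q - 1) := Real.rpow_pos_of_pos hgx _
  rw [e2] at hΦ
  rw [e3, e1, powerGap_eq k b hx0]
  set Φ := Real.log x - 1 - 1 / (1 + k) + (1 + k) / (k * x) - (x ^ k * x)⁻¹ / (k * (1 + k))
    with hΦdef
  have key : (1 - q * (x ^ k * (k * x - (1 + k) * b))) =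
      k * (1 + k) * x ^ k * x * (logGap b (1 + p) x - Φ) := by
    rw [hΦdef, logGap, hb, hqdef]
    have := h1p.ne'
    field_simp
    ring
  rw [key]
  have : (x - b) / x ^ 2 * q * logGap b (1 + p) x ^ (q - 1) *
      (k * (1 + k) * x ^ k * x * (logGap b (1 + p) x - Φ)) +
      logGap b (1 + p) x ^ (q - 1) * logGap b (1 + p) x *
        -(q * (k * (1 + k) * (x ^ k / x) * (x - b))) =
      -((x - b) / x * q * logGap b (1 + p) x ^ (q - 1) * (k * (1 + k) * x ^ k) * Φ) := by
    field_simp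
    ring
  rw [this, neg_lt_zero]
  have := sub_pos.2 hbx
  positivity

lemma SystemS.logGap_eq {κ δ p α y η : ℝ} (h : SystemS κ δ p α y η) :
    α * logGap (1 / (1 - p)) (1 + p) η = logGap 1 1 y := by
  have e : α / (η * (1 - p)) = α * (1 / (1 - p) / η) := by
    rw [div_div, mul_one_div, mul_comm η]
  have h1 := h.1
  rw [e] at h1
  simp only [logGap]
  linarith

lemma SystemS.powerGap_eq {κ δ p α y η : ℝ} (hκ : 0 < κ) (hδ : 0 < δ) (hp : p < 1)
    (hα : 0 < α) (h : SystemS κ δ p α y η) :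
    1 - (p * (1 + κ * δ) - 1) * powerGap (κ * δ) (1 / (1 - p)) η =
      α ^ (p * (1 + κ * δ) - 1) * (1 + powerGap (κ * δ) 1 y) := by
  have h2 := h.2
  have h1p : 1 - p ≠ 0 := (sub_pos.2 hp).ne'
  have hm : 1 + κ * δ ≠ 0 := by positivity
  have hA : α ^ (p * (1 + κ * δ) - 1) ≠ 0 := (Real.rpow_pos_of_pos hα _).ne'
  rw [← neg_sub (p * (1 + κ * δ)) 1, Real.rpow_neg hα.le] at h2
  simp only [powerGap]
  generalize α ^ (p * (1 + κ * δ) - 1) = A at *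
  generalize η ^ (1 + κ * δ) = a at *
  generalize η ^ (κ * δ) = b at *
  generalize y ^ (1 + κ * δ) = c at *
  generalize y ^ (κ * δ) = d at *
  have h3 := congrArg (fun t => t * (A * δ * (1 + κ * δ))) h2
  have l : (A⁻¹ * (p * (1 + κ * δ) - 1) * (κ * a / (1 + κ * δ) - b / (δ * (1 - p))) +
      (κ * c / (1 + κ * δ) - d / δ)) * (A * δ * (1 + κ * δ)) =
      (p * (1 + κ * δ) - 1) * (κ * δ * a - (1 + κ * δ) * (1 / (1 - p)) * b) +
      A * (κ * δ * c - (1 + κ * δ) * 1 * d) := by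
    field_simp
  have r : (A⁻¹ - 1) / (δ * (1 + κ * δ)) * (A * δ * (1 + κ * δ)) = 1 - A := by
    field_simp
  simp only [l, r] at h3
  linarith

/-- In a solution of the system, `η` lies beyond the critical point `1 / (1 - p)`. -/
lemma SystemS.lt_eta {κ δ p α y η : ℝ} (hκ : 0 < κ) (hδ : 0 < δ) (hp0 : 0 < p) (hp : p < 1)
    (hq : 0 < p * (1 + κ * δ) - 1) (hα : 0 < α) (hα1 : α < 1) (hy : y ∈ Ioo (0 : ℝ) 1)
    (hη : 1 < η) (h : SystemS κ δ p α y η) : 1 / (1 - p) < η := by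
  by_contra! hle
  have hk : 0 < κ * δ := mul_pos hκ hδ
  have h1p : 0 < 1 - p := sub_pos.2 hp
  have hb1 : 1 < 1 / (1 - p) := by
    rw [lt_div_iff₀ h1p]
    linarith
  have hanti := antitoneOn_powerGap hk (1 / (1 - p)) ⟨zero_lt_one, hb1.le⟩
    ⟨zero_lt_one.trans hη, hle⟩ hη.le
  have hone : powerGap (κ * δ) (1 / (1 - p)) 1 < 0 := by
    rw [_root_.powerGap_eq _ _ zero_lt_one, Real.one_rpow]
    nlinarith
  have hH := one_add_powerGap_one_pos hk hy.1 hy.2.ne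
  have hH1 : powerGap (κ * δ) 1 y < 0 := by
    rw [_root_.powerGap_eq _ _ hy.1]
    exact mul_neg_of_pos_of_neg (Real.rpow_pos_of_pos hy.1 _) (by nlinarith [hy.2])
  have hA : α ^ (p * (1 + κ * δ) - 1) < 1 := Real.rpow_lt_one hα.le hα1 hq
  have hE := h.powerGap_eq hκ hδ hp hα
  have h1 : α ^ (p * (1 + κ * δ) - 1) * (1 + powerGap (κ * δ) 1 y) < 1 :=
    mul_lt_one_of_nonneg_of_lt_one_left (Real.rpow_pos_of_pos hα _).le hA (by linarith)
  nlinarith [mul_neg_of_pos_of_neg hq (hanti.trans_lt hone)]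

/-- Eliminating `α` from the system. -/
lemma SystemS.rpow_mul_eq {κ δ p α y η : ℝ} (hκ : 0 < κ) (hδ : 0 < δ) (hp : p < 1)
    (hα : 0 < α) (hg : 0 < logGap (1 / (1 - p)) (1 + p) η) (h : SystemS κ δ p α y η) :
    logGap (1 / (1 - p)) (1 + p) η ^ (p * (1 + κ * δ) - 1) *
      (1 - (p * (1 + κ * δ) - 1) * powerGap (κ * δ) (1 / (1 - p)) η) =
    logGap 1 1 y ^ (p * (1 + κ * δ) - 1) * (1 + powerGap (κ * δ) 1 y) := by
  rw [h.powerGap_eq hκ hδ hp hα, ← h.logGap_eq, Real.mul_rpow hα.le hg.le]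
  ring

theorem stmt16 (μ σ δ p : ℝ) (κ : ℝ)
    (hμ : 0 < μ) (hσ : 0 < σ) (hδ : 0 < δ) (hκ : κ = 2 * σ ^ 2 / μ ^ 2)
    (hp1 : 1 / (1 + κ * δ) < p) (hp2 : p < 1)
    (α₁ α₂ : ℝ) (hα₁ : 0 < α₁) (h12 : α₁ < α₂) (hα₂ : α₂ < 1)
    (y₁ η₁ y₂ η₂ : ℝ)
    (hy₁ : y₁ ∈ Set.Ioo (0 : ℝ) 1) (hη₁ : 1 < η₁)
    (hS₁ : SystemS κ δ p α₁ y₁ η₁)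
    (hy₂ : y₂ ∈ Set.Ioo (0 : ℝ) 1) (hη₂ : 1 < η₂)
    (hS₂ : SystemS κ δ p α₂ y₂ η₂) :
    κ * p / (p * (1 + κ * δ) - 1) * (1 / y₁ - (1 - p)) <
        κ * p / (p * (1 + κ * δ) - 1) * (1 / y₂ - (1 - p)) ∧
      y₂ < y₁ := by
  have hκ0 : 0 < κ := by
    rw [hκ]
    positivity
  have hk : 0 < κ * δ := mul_pos hκ0 hδ
  have hp0 : 0 < p := lt_trans (by positivity) hp1
  have hq : 0 < p * (1 + κ * δ) - 1 := by
    rw [div_lt_iff₀ (by positivity)] at hp1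
    linarith
  have hb0 : 0 < 1 / (1 - p) := one_div_pos.2 (sub_pos.2 hp2)
  have hα₂0 : 0 < α₂ := hα₁.trans h12
  have hy : y₂ < y₁ := by
    by_contra! hle
    have hb₁ := hS₁.lt_eta hκ0 hδ hp0 hp2 hq hα₁ (h12.trans hα₂) hy₁ hη₁
    have hb₂ := hS₂.lt_eta hκ0 hδ hp0 hp2 hq hα₂0 hα₂ hy₂ hη₂
    have hf₁ := logGap_one_one_pos hy₁.1 hy₁.2
    have hf₂ := logGap_one_one_pos hy₂.1 hy₂.2
    have hf := antitoneOn_logGap 1 1 ⟨hy₁.1, hy₁.2.le⟩ ⟨hy₂.1, hy₂.2.le⟩ hle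
    have hH := antitoneOn_powerGap hk 1 ⟨hy₁.1, hy₁.2.le⟩ ⟨hy₂.1, hy₂.2.le⟩ hle
    have hE₁ := hS₁.logGap_eq
    have hE₂ := hS₂.logGap_eq
    have hg₁ : 0 < logGap (1 / (1 - p)) (1 + p) η₁ :=
      pos_of_mul_pos_right (hE₁ ▸ hf₁) hα₁.le
    have hg₂ : 0 < logGap (1 / (1 - p)) (1 + p) η₂ :=
      pos_of_mul_pos_right (hE₂ ▸ hf₂) hα₂0.le
    have hη : η₂ < η₁ := by
      by_contra! hηle
      have hg := monotoneOn_logGap hb0 (1 + p) hb₁.le hb₂.le hηle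
      nlinarith
    have hR := strictAntiOn_logGap_rpow_mul hk hp0 hp2 hq hb₂.le hg₂
      (left_mem_Icc.2 hη.le) (right_mem_Icc.2 hη.le) hη
    simp only at hR
    rw [hS₁.rpow_mul_eq hκ0 hδ hp2 hα₁ hg₁, hS₂.rpow_mul_eq hκ0 hδ hp2 hα₂0 hg₂] at hR
    refine hR.not_ge (mul_le_mul (Real.rpow_le_rpow hf₂.le hf hq.le) (by linarith) ?_ ?_)
    · exact (one_add_powerGap_one_pos hk hy₂.1 hy₂.2.ne).le
    · exact Real.rpow_nonneg hf₁.le _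
  refine ⟨mul_lt_mul_of_pos_left (sub_lt_sub_right ?_ _) (by positivity), hy⟩
  exact one_div_lt_one_div_of_lt hy₂.1 hy

end
end

section
/- One has Û(y*) = (κp²/(p(1+κδ)−1))·(1/(1−p) − y*). -/
open Real Set

noncomputable section

theorem stmt17 (μ σ δ p α κ : ℝ)
    (hμ : 0 < μ) (hσ : 0 < σ) (hδ : 0 < δ) (hκ : κ = 2 * σ ^ 2 / μ ^ 2)
    (hα : α ∈ Set.Ioo (0 : ℝ) 1) (hp1 : 1 / (1 + κ * δ) < p) (hp2 : p < 1) (ystar ηstar y0 : ℝ)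
    (hy : ystar ∈ Set.Ioo (0 : ℝ) 1) (hη : 1 < ηstar)
    (hS : SystemS κ δ p α ystar ηstar) (hy0 : y0 = ηstar * α ^ (-p)) :
    Uhat κ δ p α ηstar ystar =
      κ * p ^ 2 / (p * (1 + κ * δ) - 1) * (1 / (1 - p) - ystar) := by
  obtain ⟨hα0, hα1⟩ := hα
  obtain ⟨hy0', hy1⟩ := hy
  obtain ⟨h1, h2⟩ := hS
  have hκ0 : 0 < κ := by rw [hκ]; positivity
  have hs : 0 < 1 + κ * δ := by positivity
  have hp0 : 0 < p := lt_trans (by positivity) hp1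
  have hq : 0 < p * (1 + κ * δ) - 1 := by
    rw [div_lt_iff₀ hs] at hp1
    linarith
  have hp : 0 < 1 - p := by linarith
  have hαp : 1 < α ^ (-p) := Real.one_lt_rpow_of_pos_of_lt_one_of_neg hα0 hα1 (by linarith)
  have hC5 : C5 κ δ p α ηstar + κ / (1 + κ * δ) * Real.log ystar =
      -(κ / (1 + κ * δ)) * (1 / ystar + p + 1 / (1 + κ * δ)) := by
    unfold C5
    linear_combination -(κ / (1 + κ * δ)) * h1
  have hC6 : C6 κ δ p α ηstar = -(1 / ((1 + κ * δ) * (p * (1 + κ * δ) - 1))) *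
      (κ * ystar ^ (1 + κ * δ) / (1 + κ * δ) - ystar ^ (κ * δ) / δ) := by
    rw [← eq_sub_iff_add_eq'] at h2
    rw [h2]
    unfold C6 C2
    generalize κ * ηstar ^ (1 + κ * δ) / (1 + κ * δ) - ηstar ^ (κ * δ) / (δ * (1 - p)) = b
    generalize α ^ (1 - p * (1 + κ * δ)) = a
    generalize 1 + κ * δ = s at *
    generalize p * s - 1 = q at *
    field_simp
    ring
  have hC6y : C6 κ δ p α ηstar * ystar ^ (-(κ * δ)) =
      -(1 / ((1 + κ * δ) * (p * (1 + κ * δ) - 1))) * (κ * ystar / (1 + κ * δ) - 1 / δ) := by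
    have hne : ystar ^ (κ * δ) ≠ 0 := (Real.rpow_pos_of_pos hy0' _).ne'
    rw [hC6, Real.rpow_neg hy0'.le, Real.rpow_add hy0', Real.rpow_one]
    field_simp
  rw [Uhat, if_neg (by linarith), if_neg (by linarith), hC6y]
  calc _ = (C5 κ δ p α ηstar + κ / (1 + κ * δ) * Real.log ystar) * ystar +
        -(1 / ((1 + κ * δ) * (p * (1 + κ * δ) - 1))) * (κ * ystar / (1 + κ * δ) - 1 / δ) +
        1 / (δ * (1 - p)) := by ring
    _ = _ := by
      rw [hC5]
      have hsne := hs.ne'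
      have hpne := hp.ne'
      generalize hQ : p * (1 + κ * δ) - 1 = q at hq ⊢
      field_simp
      rw [← hQ]
      ring

end
end

section
/- Let w* > 0 and K ∈ ℝ. Suppose f : [0, ∞) → ℝ is continuously differentiable, twice continuously differentiable on [0, w*], satisfies f(w) = K·w for all w ≥ w*, and f′(w*) = K. Then the function g(x, z) := z·f(x/z) is Lipschitz continuous on the set {(x, z) ∈ ℝ² : x ≥ 0, z > 0}. -/
open Real Set

/-- The perspective `(x, z) ↦ z * h (x / z)` of a Lipschitz function `h` on `[0, ∞)` vanishing
at `w`: Lipschitz estimate at a pair of points, the first of which lies below the ray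
`x = w * z`. -/
lemma abs_perspective_sub_le {h : ℝ → ℝ} {C w : ℝ} (hC : 0 ≤ C) (hw : 0 < w)
    (hLip : ∀ a b, 0 ≤ a → 0 ≤ b → |h a - h b| ≤ C * |a - b|) (h0 : h w = 0)
    {x z x' z' : ℝ} (hx : 0 ≤ x) (hz : 0 < z) (hx' : 0 ≤ x') (hz' : 0 < z') (hxz : x / z ≤ w) :
    |z * h (x / z) - z' * h (x' / z')| ≤ C * (2 * w * |z - z'| + |x - x'|) := by
  have ha : 0 ≤ x / z := by positivity
  have hb : 0 ≤ x' / z' := by positivity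
  have hbound : |h (x / z)| ≤ C * w := by
    have hdist := hLip (x / z) w ha hw.le
    rw [h0, sub_zero, abs_sub_comm, abs_of_nonneg (sub_nonneg.2 hxz)] at hdist
    nlinarith
  have hscaled : z' * |x / z - x' / z'| ≤ w * |z - z'| + |x - x'| := by
    have hsplit : z' * (x / z - x' / z') = -(x / z * (z - z')) + (x - x') := by
      field_simp
      ring
    rw [← abs_of_pos hz', ← abs_mul, abs_of_pos hz', hsplit]
    refine (abs_add_le _ _).trans ?_
    rw [abs_neg, abs_mul, abs_of_nonneg ha]
    gcongr
  calc |z * h (x / z) - z' * h (x' / z')|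
      = |(z - z') * h (x / z) + z' * (h (x / z) - h (x' / z'))| := by ring_nf
    _ ≤ |z - z'| * |h (x / z)| + z' * |h (x / z) - h (x' / z')| := by
      refine (abs_add_le _ _).trans_eq ?_
      rw [abs_mul, abs_mul, abs_of_pos hz']
    _ ≤ |z - z'| * (C * w) + z' * (C * |x / z - x' / z'|) := by
      gcongr
      exact hLip _ _ ha hb
    _ = |z - z'| * (C * w) + C * (z' * |x / z - x' / z'|) := by ring
    _ ≤ |z - z'| * (C * w) + C * (w * |z - z'| + |x - x'|) := by gcongr
    _ = C * (2 * w * |z - z'| + |x - x'|) := by ring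

theorem stmt18 (wstar K : ℝ) (hw : 0 < wstar) (f : ℝ → ℝ)
    (hf1 : ContDiffOn ℝ 1 f (Set.Ici 0))
    (hf2 : ContDiffOn ℝ 2 f (Set.Icc 0 wstar))
    (hfK : ∀ w : ℝ, wstar ≤ w → f w = K * w)
    (hfd : deriv f wstar = K) :
    ∃ L : NNReal,
      LipschitzOnWith L (fun q : ℝ × ℝ => q.2 * f (q.1 / q.2))
        {q : ℝ × ℝ | 0 ≤ q.1 ∧ 0 < q.2} := by
  set h : ℝ → ℝ := fun w => f w - K * w with hh
  have hvanish : ∀ w, wstar ≤ w → h w = 0 := fun w hle => by simp [hh, hfK w hle]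
  have hsmooth : ContDiffOn ℝ 1 h (Set.Icc 0 wstar) :=
    (hf1.mono Set.Icc_subset_Ici_self).sub (contDiffOn_const.mul contDiffOn_id)
  obtain ⟨C, hC⟩ :=
    hsmooth.exists_lipschitzOnWith one_ne_zero (convex_Icc 0 wstar) isCompact_Icc
  have hmin : ∀ a, h a = h (min a wstar) := fun a => by
    rcases le_total a wstar with hle | hle
    · rw [min_eq_left hle]
    · rw [min_eq_right hle, hvanish a hle, hvanish wstar le_rfl]
  have hLip : ∀ a b, 0 ≤ a → 0 ≤ b → |h a - h b| ≤ C * |a - b| := fun a b ha hb => by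
    rw [hmin a, hmin b]
    refine (hC.dist_le_mul _ ⟨le_min ha hw.le, min_le_right _ _⟩ _
      ⟨le_min hb hw.le, min_le_right _ _⟩).trans ?_
    rw [Real.dist_eq]
    refine mul_le_mul_of_nonneg_left ?_ C.2
    simpa using abs_min_sub_min_le_max a wstar b wstar
  have hpersp : ∀ x z x' z' : ℝ, 0 ≤ x → 0 < z → 0 ≤ x' → 0 < z' →
      |z * h (x / z) - z' * h (x' / z')| ≤ C * (2 * wstar * |z - z'| + |x - x'|) := by
    intro x z x' z' hx hz hx' hz'
    rcases le_total (x / z) wstar with hle | hle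
    · exact abs_perspective_sub_le C.2 hw hLip (hvanish _ le_rfl) hx hz hx' hz' hle
    rcases le_total (x' / z') wstar with hle' | hle'
    · rw [abs_sub_comm, abs_sub_comm z, abs_sub_comm x]
      exact abs_perspective_sub_le C.2 hw hLip (hvanish _ le_rfl) hx' hz' hx hz hle'
    · rw [hvanish _ hle, hvanish _ hle', mul_zero, mul_zero, sub_zero, abs_zero]
      positivity
  refine ⟨⟨C * (2 * wstar + 1) + |K|, by positivity⟩, LipschitzOnWith.of_dist_le_mul ?_⟩
  rintro ⟨x, z⟩ ⟨hx, hz⟩ ⟨x', z'⟩ ⟨hx', hz'⟩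
  dsimp only at hx hz hx' hz'
  rw [Prod.dist_eq, Real.dist_eq, Real.dist_eq, Real.dist_eq]
  dsimp only [NNReal.coe_mk]
  have hdecomp : z * f (x / z) - z' * f (x' / z') =
      (z * h (x / z) - z' * h (x' / z')) + K * (x - x') := by
    simp only [hh]
    field_simp
    ring
  set M := max |x - x'| |z - z'|
  have hxM : |x - x'| ≤ M := le_max_left _ _
  have hzM : |z - z'| ≤ M := le_max_right _ _
  calc |z * f (x / z) - z' * f (x' / z')|
      ≤ C * (2 * wstar * |z - z'| + |x - x'|) + |K| * |x - x'| := by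
        rw [hdecomp, ← abs_mul]
        exact (abs_add_le _ _).trans (add_le_add_left (hpersp x z x' z' hx hz hx' hz') _)
    _ ≤ C * (2 * wstar * M + M) + |K| * M := by gcongr
    _ = (C * (2 * wstar + 1) + |K|) * M := by ring
end

section
/- As α → 0+, one has y*(α) → 1 and w*(α) → κp²/(p(1+κδ)−1). -/
open Real Set

noncomputable section

/-- The second equation of the system bounds `η` uniformly in `α` and `y`. -/
lemma SystemS.eta_le {κ δ p α y η : ℝ} (hκ : 0 < κ) (hδ : 0 < δ)
    (hp : 0 < p * (1 + κ * δ) - 1) (hα : α ∈ Set.Ioo (0 : ℝ) 1) (hy : y ∈ Set.Ioo (0 : ℝ) 1)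
    (hη : 1 < η) (h : SystemS κ δ p α y η) (hp' : p < 1) :
    η ≤ (1 / (δ * (1 - p)) + 2 / (δ * (p * (1 + κ * δ) - 1))) * ((1 + κ * δ) / κ) := by
  obtain ⟨-, h⟩ := h
  have ha : 0 < κ * δ := mul_pos hκ hδ
  have hq : 0 < 1 - p := by linarith
  have hN : 1 ≤ α ^ (1 - p * (1 + κ * δ)) :=
    Real.one_le_rpow_of_pos_of_le_one_of_nonpos hα.1 hα.2.le (by linarith)
  have hya : y ^ (κ * δ) ≤ 1 := Real.rpow_le_one hy.1.le hy.2.le ha.le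
  have hya' : 0 < y ^ (1 + κ * δ) := Real.rpow_pos_of_pos hy.1 _
  have hηa : 1 ≤ η ^ (κ * δ) := Real.one_le_rpow hη.le ha.le
  rw [Real.rpow_add (by linarith) 1, Real.rpow_one] at h
  set N := α ^ (1 - p * (1 + κ * δ))
  set Y := y ^ (1 + κ * δ)
  set H := η ^ (κ * δ)
  set q := p * (1 + κ * δ) - 1
  set X := κ * η / (1 + κ * δ) - 1 / (δ * (1 - p)) with hX
  have hHX : κ * (η * H) / (1 + κ * δ) - H / (δ * (1 - p)) = H * X := by
    rw [hX]; ring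
  rw [hHX] at h
  have hY : 0 < κ * Y / (1 + κ * δ) := by positivity
  have hy1 : y ^ (κ * δ) / δ ≤ 1 / δ := by gcongr
  have hN1 : (N - 1) / (δ * (1 + κ * δ)) ≤ N / δ := by
    apply div_le_div₀ (by linarith) (by linarith) hδ
    nlinarith
  have hN2 : 1 / δ ≤ N / δ := by gcongr
  have hHX' : q * (H * X) ≤ 2 / δ := by
    have : N * (q * (H * X)) ≤ N * (2 / δ) := by
      have e : N * (2 / δ) = N / δ + N / δ := by ring
      rw [e]
      linarith
    exact le_of_mul_le_mul_left this (by linarith)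
  have hXle : X ≤ 2 / (δ * q) := by
    rcases le_total X 0 with h0 | h0
    · exact h0.trans (by positivity)
    · have h1 : X ≤ H * X := by nlinarith
      have h2 : H * X ≤ 2 / (δ * q) := by
        rw [← div_div, le_div_iff₀ hp]
        linarith
      exact h1.trans h2
  have hη' : η = (κ * η / (1 + κ * δ)) * ((1 + κ * δ) / κ) := by
    field_simp
  rw [hη']
  gcongr
  linarith

/-- A quadratic lower bound for `t - 1 - log t`, written with `t = 1 / y`. -/
lemma sq_sqrt_one_div_sub_one_le {y : ℝ} (hy : 0 < y) :
    (√(1 / y) - 1) ^ 2 ≤ 1 / y + Real.log y - 1 := by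
  have ht : 0 < 1 / y := by positivity
  have hs : √(1 / y) ^ 2 = 1 / y := Real.sq_sqrt ht.le
  have h1 := Real.log_le_sub_one_of_pos (Real.sqrt_pos.2 ht)
  rw [Real.log_sqrt ht.le, one_div, Real.log_inv, ← one_div] at h1
  nlinarith

theorem stmt19 (μ σ δ p : ℝ) (κ : ℝ)
    (hμ : 0 < μ) (hσ : 0 < σ) (hδ : 0 < δ) (hκ : κ = 2 * σ ^ 2 / μ ^ 2)
    (hp1 : 1 / (1 + κ * δ) < p) (hp2 : p < 1)
    (ystar ηstar : ℝ → ℝ)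
    (hsol : ∀ α ∈ Set.Ioo (0 : ℝ) 1,
      ystar α ∈ Set.Ioo (0 : ℝ) 1 ∧ 1 < ηstar α ∧
        SystemS κ δ p α (ystar α) (ηstar α)) :
    Filter.Tendsto ystar (nhdsWithin 0 (Set.Ioo (0 : ℝ) 1)) (nhds 1) ∧
      Filter.Tendsto
        (fun α => κ * p / (p * (1 + κ * δ) - 1) * (1 / ystar α - (1 - p)))
        (nhdsWithin 0 (Set.Ioo (0 : ℝ) 1))
        (nhds (κ * p ^ 2 / (p * (1 + κ * δ) - 1))) := by
  have hκ0 : 0 < κ := by rw [hκ]; positivity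
  have hq : 0 < p * (1 + κ * δ) - 1 := by
    rw [div_lt_iff₀ (by positivity)] at hp1
    linarith
  have hp0 : 0 < p := lt_trans (by positivity) hp1
  have hp' : 0 < 1 - p := by linarith
  obtain ⟨M, hM⟩ : ∃ M, ∀ α ∈ Set.Ioo (0 : ℝ) 1, ηstar α ≤ M :=
    ⟨_, fun α hα => (hsol α hα).2.2.eta_le hκ0 hδ hq hα (hsol α hα).1 (hsol α hα).2.1 hp2⟩
  have hbound : ∀ α ∈ Set.Ioo (0 : ℝ) 1,
      |√(1 / ystar α) - 1| ≤ √(α * (M + 1 / (1 - p))) := by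
    intro α hα
    obtain ⟨hy, hη, hE, -⟩ := hsol α hα
    apply Real.abs_le_sqrt
    refine (sq_sqrt_one_div_sub_one_le hy.1).trans ?_
    have hη0 : 0 < ηstar α := by linarith
    have h1 : Real.log (ηstar α) ≤ M := by
      linarith [Real.log_le_sub_one_of_pos hη0, hM α hα]
    have h2 : 1 / (ηstar α * (1 - p)) ≤ 1 / (1 - p) := by
      apply one_div_le_one_div_of_le hp'
      nlinarith
    have h3 : α * (Real.log (ηstar α) + 1 / (ηstar α * (1 - p)))
        ≤ α * (M + 1 / (1 - p)) := mul_le_mul_of_nonneg_left (by linarith) hα.1.le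
    have h4 : α * (Real.log (ηstar α) + 1 / (ηstar α * (1 - p)))
        = α * Real.log (ηstar α) + α / (ηstar α * (1 - p)) := by ring
    have h5 : 0 < α * (1 + p) := mul_pos hα.1 (by linarith)
    linarith
  have hsqrt : Filter.Tendsto (fun α => √(1 / ystar α))
      (nhdsWithin 0 (Set.Ioo (0 : ℝ) 1)) (nhds 1) := by
    rw [tendsto_iff_norm_sub_tendsto_zero]
    refine squeeze_zero' (Filter.Eventually.of_forall fun _ => norm_nonneg _)
      (eventually_nhdsWithin_of_forall hbound) ?_
    have hc : Continuous fun α : ℝ => √(α * (M + 1 / (1 - p))) := by fun_prop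
    simpa using (hc.tendsto 0).mono_left nhdsWithin_le_nhds
  have hinv : Filter.Tendsto (fun α => 1 / ystar α)
      (nhdsWithin 0 (Set.Ioo (0 : ℝ) 1)) (nhds 1) := by
    have h := hsqrt.pow 2
    rw [one_pow] at h
    refine h.congr' (eventually_nhdsWithin_of_forall fun α hα => ?_)
    exact Real.sq_sqrt (one_div_nonneg.2 (hsol α hα).1.1.le)
  refine ⟨by simpa using hinv.inv₀ one_ne_zero, ?_⟩
  have h := (hinv.sub_const (1 - p)).const_mul (κ * p / (p * (1 + κ * δ) - 1))
  convert h using 2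
  ring

end
end
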